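/- Let n ≥ 3, let p ∈ (0,1/2], and let F be an odd-cycle-intersecting family of subgraphs of the complete graph K_n. Then μ_p(F) ≤ p^3, and equality holds if and only if F is a △umvirate, i.e. F = {G ⊆ E_n : T ⊆ G} for some fixed triangle T. -/

import Mathlib

/-- The edge set of the complete graph `K_n` on vertex set `Fin n`:
all non-diagonal unordered pairs. -/
def edgeFinset (n : ℕ) : Finset (Sym2 (Fin n)) :=
  Finset.univ.filter (fun e => ¬ e.IsDiag)

/-- `T` is a triangle: the three edges on three distinct vertices. -/
def IsTriangle {n : ℕ} (T : Finset (Sym2 (Fin n))) : Prop :=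
  ∃ a b c : Fin n, a ≠ b ∧ a ≠ c ∧ b ≠ c ∧ T = {s(a, b), s(a, c), s(b, c)}

/-- The simple graph on `Fin n` with edge set `G`. -/
def graphOf {n : ℕ} (G : Finset (Sym2 (Fin n))) : SimpleGraph (Fin n) :=
  SimpleGraph.fromEdgeSet (G : Set (Sym2 (Fin n)))

/-- The graph `G` contains a cycle of odd length. -/
def HasOddCycle {n : ℕ} (G : Finset (Sym2 (Fin n))) : Prop :=
  ∃ (v : Fin n) (w : (graphOf G).Walk v v), w.IsCycle ∧ Odd w.length

/-- A family of graphs is odd-cycle-intersecting if the intersection of any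
two members contains an odd cycle. -/
def OddCycleIntersecting {n : ℕ} (F : Finset (Finset (Sym2 (Fin n)))) : Prop :=
  ∀ G ∈ F, ∀ H ∈ F, HasOddCycle (G ∩ H)

/-- The `p`-biased measure of a graph `G ⊆ E_n`. -/
noncomputable def muP (n : ℕ) (p : ℝ) (G : Finset (Sym2 (Fin n))) : ℝ :=
  p ^ G.card * (1 - p) ^ (n.choose 2 - G.card)

/-- The `p`-biased measure of a family of graphs. -/
noncomputable def muPFam (n : ℕ) (p : ℝ) (F : Finset (Finset (Sym2 (Fin n)))) : ℝ :=
  ∑ G ∈ F, muP n p G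

section Walsh

variable {ι : Type*} [DecidableEq ι]

/-- The Walsh character of the cube of subsets of `ι` indexed by `S`. -/
def walsh (S G : Finset ι) : ℝ := ∏ e ∈ S, if e ∈ G then -1 else 1

lemma walsh_eq_pow (S G : Finset ι) : walsh S G = (-1) ^ (S ∩ G).card := by
  rw [walsh, Finset.prod_ite, Finset.prod_const, Finset.prod_const_one, mul_one,
    Finset.filter_mem_eq_inter]

lemma walsh_comm (S G : Finset ι) : walsh S G = walsh G S := by
  rw [walsh_eq_pow, walsh_eq_pow, Finset.inter_comm]

lemma walsh_sq (S G : Finset ι) : walsh S G * walsh S G = 1 := by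
  rw [walsh_eq_pow, ← mul_pow]; simp

lemma walsh_symmDiff (S G H : Finset ι) :
    walsh S (symmDiff G H) = walsh S G * walsh S H := by
  rw [walsh, walsh, walsh, ← Finset.prod_mul_distrib]
  refine Finset.prod_congr rfl fun e _ => ?_
  by_cases hG : e ∈ G <;> by_cases hH : e ∈ H <;> simp [Finset.mem_symmDiff, hG, hH]

lemma sum_powerset_walsh (C D : Finset ι) :
    ∑ A ∈ C.powerset, walsh A D = if Disjoint C D then 2 ^ C.card else 0 := by
  simp only [walsh]
  rw [← Finset.prod_one_add]
  split_ifs with h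
  · rw [← Finset.prod_const]
    refine Finset.prod_congr rfl fun e he => ?_
    rw [if_neg (Finset.disjoint_left.mp h he)]; norm_num
  · obtain ⟨e, heC, heD⟩ := Finset.not_disjoint_iff.mp h
    exact Finset.prod_eq_zero heC (by simp [heD])

variable [Fintype ι]

lemma walsh_univ (S : Finset ι) : walsh S Finset.univ = (-1) ^ S.card := by
  rw [walsh_eq_pow, Finset.inter_univ]

lemma sum_walsh (D : Finset ι) :
    ∑ A, walsh A D = if D = ∅ then 2 ^ Fintype.card ι else 0 := by
  have h := sum_powerset_walsh Finset.univ D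
  rw [Finset.powerset_univ] at h
  rw [h, Finset.card_univ]
  congr 1
  simp [Finset.disjoint_left, Finset.eq_empty_iff_forall_notMem]

/-- The Walsh–Fourier coefficient of `f` at `S`. -/
noncomputable def walshCoeff (f : Finset ι → ℝ) (S : Finset ι) : ℝ :=
  (∑ G, f G * walsh S G) / 2 ^ Fintype.card ι

lemma sum_walshCoeff_mul_walsh (f : Finset ι → ℝ) (G : Finset ι) :
    ∑ S, walshCoeff f S * walsh S G = f G := by
  have h : ∀ S, walshCoeff f S * walsh S G
      = ∑ H, f H * walsh S (symmDiff H G) / 2 ^ Fintype.card ι := by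
    intro S
    rw [walshCoeff, div_mul_eq_mul_div, Finset.sum_mul, Finset.sum_div]
    simp only [walsh_symmDiff, mul_assoc]
  simp only [h]
  rw [Finset.sum_comm]
  simp only [← Finset.sum_div, ← Finset.mul_sum, sum_walsh]
  rw [Finset.sum_eq_single G]
  · simp
  · intro H _ hne
    rw [if_neg (by simpa [← Finset.bot_eq_empty, symmDiff_eq_bot] using hne)]; simp
  · simp

lemma sum_walshCoeff_sq_mul_walsh (f : Finset ι → ℝ) (B : Finset ι) :
    ∑ S, walshCoeff f S ^ 2 * walsh S B
      = (∑ G, f G * f (symmDiff G B)) / 2 ^ Fintype.card ι := by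
  have h : ∀ G, f G * f (symmDiff G B)
      = ∑ S, f G * walsh S G * (walshCoeff f S * walsh S B) := by
    intro G
    rw [← sum_walshCoeff_mul_walsh f (symmDiff G B), Finset.mul_sum]
    refine Finset.sum_congr rfl fun S _ => ?_
    rw [walsh_symmDiff]; ring
  simp only [h]
  rw [Finset.sum_comm, Finset.sum_div]
  refine Finset.sum_congr rfl fun S _ => ?_
  rw [← Finset.sum_mul, mul_div_right_comm, ← walshCoeff]; ring

/-- Averaging the top derivative: if `S` is maximal in the Walsh support of `f`, the alternating
sums of `f` over all translates of the subcube on `S` are nonzero. -/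
lemma sum_powerset_walsh_mul_ne_zero (f : Finset ι → ℝ) (S : Finset ι)
    (hS : walshCoeff f S ≠ 0) (hmax : ∀ S', S ⊂ S' → walshCoeff f S' = 0) (B : Finset ι) :
    ∑ A ∈ S.powerset, walsh A S * f (symmDiff B A) ≠ 0 := by
  have key : ∑ A ∈ S.powerset, walsh A S * f (symmDiff B A)
      = walshCoeff f S * walsh S B * 2 ^ S.card := by
    have h : ∀ A, walsh A S * f (symmDiff B A)
        = ∑ S', walshCoeff f S' * walsh S' B * walsh A (symmDiff S S') := by
      intro A
      rw [← sum_walshCoeff_mul_walsh f (symmDiff B A), Finset.mul_sum]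
      refine Finset.sum_congr rfl fun S' _ => ?_
      rw [walsh_symmDiff, walsh_symmDiff, walsh_comm S' A]; ring
    simp only [h]
    rw [Finset.sum_comm]
    simp only [← Finset.mul_sum, sum_powerset_walsh]
    rw [Finset.sum_eq_single S]
    · simp
    · intro S' _ hne
      by_cases hd : Disjoint S (symmDiff S S')
      · have hsub : S ⊆ S' := by
          intro e he
          by_contra he'
          exact Finset.disjoint_left.mp hd he (by simp [Finset.mem_symmDiff, he, he'])
        rw [hmax S' (hsub.ssubset_of_ne (Ne.symm hne))]; simp
      · rw [if_neg hd, mul_zero]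
    · simp
  rw [key]
  refine mul_ne_zero (mul_ne_zero hS ?_) (by positivity)
  intro h0
  have := walsh_sq S B
  simp [h0] at this

/-- If `f` vanishes at `G` or at `G ∆ Aᶜ` for all `A ⊆ C` and all `G`, then the signed squared
Walsh coefficients integrate to zero every function of the trace on `C`. -/
lemma sum_walshCoeff_sq_mul_trace (f : Finset ι → ℝ) (C : Finset ι)
    (hf : ∀ A ⊆ C, ∀ G, f G * f (symmDiff G Aᶜ) = 0) (g : Finset ι → ℝ) :
    ∑ S, walshCoeff f S ^ 2 * ((-1) ^ S.card * g (S ∩ C)) = 0 := by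
  have hA : ∀ A ⊆ C, ∑ S, walshCoeff f S ^ 2 * ((-1) ^ S.card * walsh S A) = 0 := by
    intro A hAC
    have h := sum_walshCoeff_sq_mul_walsh f Aᶜ
    rw [Finset.sum_eq_zero fun G _ => hf A hAC G, zero_div] at h
    rw [← h]
    refine Finset.sum_congr rfl fun S _ => ?_
    rw [← walsh_univ, ← walsh_symmDiff]
    congr 2
    ext e; simp [Finset.mem_symmDiff]
  have hg : ∀ S, g (S ∩ C) = ∑ H ∈ C.powerset, ∑ A ∈ C.powerset,
      g H / 2 ^ C.card * walsh H A * walsh S A := by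
    intro S
    have h1 : ∀ H ∈ C.powerset, ∑ A ∈ C.powerset, g H / 2 ^ C.card * walsh H A * walsh S A
        = if H = S ∩ C then g H else 0 := by
      intro H hH
      rw [Finset.mem_powerset] at hH
      have h2 : ∀ A, g H / 2 ^ C.card * walsh H A * walsh S A
          = g H / 2 ^ C.card * walsh A (symmDiff H S) := by
        intro A
        rw [walsh_symmDiff, walsh_comm H, walsh_comm S]; ring
      simp only [h2]
      rw [← Finset.mul_sum, sum_powerset_walsh]
      have h3 : Disjoint C (symmDiff H S) ↔ H = S ∩ C := by
        rw [Finset.disjoint_left, Finset.ext_iff]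
        refine forall_congr' fun e => ?_
        have := @hH e
        rw [Finset.mem_symmDiff, Finset.mem_inter]
        tauto
      by_cases h4 : H = S ∩ C
      · rw [if_pos (h3.mpr h4), if_pos h4]
        field_simp
      · rw [if_neg (fun h => h4 (h3.mp h)), if_neg h4, mul_zero]
    rw [Finset.sum_congr rfl h1, Finset.sum_ite_eq', if_pos (by simp)]
  calc ∑ S, walshCoeff f S ^ 2 * ((-1) ^ S.card * g (S ∩ C))
      = ∑ S, ∑ H ∈ C.powerset, ∑ A ∈ C.powerset, g H / 2 ^ C.card * walsh H A *
          (walshCoeff f S ^ 2 * ((-1) ^ S.card * walsh S A)) := by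
        refine Finset.sum_congr rfl fun S _ => ?_
        rw [hg S, Finset.mul_sum, Finset.mul_sum]
        refine Finset.sum_congr rfl fun H _ => ?_
        rw [Finset.mul_sum, Finset.mul_sum]
        refine Finset.sum_congr rfl fun A _ => ?_
        ring
    _ = 0 := by
        rw [Finset.sum_comm]
        refine Finset.sum_eq_zero fun H _ => ?_
        rw [Finset.sum_comm]
        refine Finset.sum_eq_zero fun A hA' => ?_
        rw [← Finset.mul_sum, hA A (Finset.mem_powerset.mp hA'), mul_zero]

end Walsh

section CutStatistics

variable {ι X : Type*} [AddCommGroup X] (ℓ : ι → X →+ ZMod 2)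

/-- The edges of `S` on which the functional takes the value one at `x`. -/
def cutEdges (S : Finset ι) (x : X) : Finset ι := S.filter fun e => ℓ e x = 1

/-- No point of `X` cuts exactly one edge of `S`. -/
def Bridgeless (S : Finset ι) : Prop := ∀ x, (cutEdges ℓ S x).card ≠ 1

/-- The averaging operator describing the effect of one bridge on the cut statistics. -/
noncomputable def bridgeAvg (ψ : ℕ → ℝ) (k : ℕ) : ℝ := (ψ k + ψ (k + 1)) / 2

/-- The function of the cut size used in the spectral argument. -/
def cutWeight (k : ℕ) : ℝ :=
  if k = 0 then 28 else if k = 1 then -20 else if k = 2 then -4 else if k = 3 then 3 else 0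

lemma bridgeAvg_iterate_cutWeight (m : ℕ) :
    bridgeAvg^[m] cutWeight = fun k =>
      (if k = 0 then 28 - 20 * (m : ℝ) - 2 * m * (m - 1) + m * (m - 1) * (m - 2) / 2
        else if k = 1 then -20 - 4 * (m : ℝ) + 3 * m * (m - 1) / 2
        else if k = 2 then 3 * (m : ℝ) - 4
        else if k = 3 then 3 else 0) / 2 ^ m := by
  induction m with
  | zero => ext k; simp [cutWeight]
  | succ m ih =>
    rw [Function.iterate_succ', Function.comp, ih]
    ext k
    rcases k with _ | _ | _ | _ | k <;> simp [bridgeAvg] <;> field_simp <;> ring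

/-- The sign character of `ZMod 2`. -/
def zmodSign (a : ZMod 2) : ℝ := if a = 1 then -1 else 1

lemma zmodSign_add (a b : ZMod 2) : zmodSign (a + b) = zmodSign a * zmodSign b := by
  have h : ∀ a : ZMod 2, a = 0 ∨ a = 1 := by decide
  have h2 : (1 + 1 : ZMod 2) = 0 := by decide
  rcases h a with rfl | rfl <;> rcases h b with rfl | rfl <;> simp [zmodSign, h2]

lemma zmodSign_natCast (k : ℕ) : zmodSign k = (-1) ^ k := by
  induction k with
  | zero => simp [zmodSign]
  | succ k ih => rw [Nat.cast_succ, zmodSign_add, ih, pow_succ]; simp [zmodSign]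

lemma zmod_two_add_one_eq_one (a : ZMod 2) : a + 1 = 1 ↔ ¬ a = 1 := by
  revert a; decide

lemma card_cutEdges_cast (S : Finset ι) (x : X) :
    ((cutEdges ℓ S x).card : ZMod 2) = (∑ e ∈ S, ℓ e) x := by
  have h : ∀ a : ZMod 2, (if a = 1 then 1 else 0) = a := by decide
  rw [cutEdges, Finset.card_filter, AddMonoidHom.finsetSum_apply, Nat.cast_sum]
  refine Finset.sum_congr rfl fun e _ => ?_
  rw [Nat.cast_ite, Nat.cast_one, Nat.cast_zero, h]

lemma sum_zmodSign (S : Finset ι) (x : X) :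
    ∑ e ∈ S, zmodSign (ℓ e x) = S.card - 2 * (cutEdges ℓ S x).card := by
  rw [cutEdges, Finset.card_filter, Finset.card_eq_sum_ones]
  push_cast
  rw [Finset.mul_sum, ← Finset.sum_sub_distrib]
  refine Finset.sum_congr rfl fun e _ => ?_
  rw [zmodSign]; split_ifs <;> norm_num

variable [Fintype X]

lemma sum_zmodSign_eq_zero (σ : X →+ ZMod 2) (hσ : σ ≠ 0) : ∑ x, zmodSign (σ x) = 0 := by
  obtain ⟨y, hy⟩ : ∃ y, σ y ≠ 0 := by
    by_contra! h
    exact hσ (AddMonoidHom.ext h)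
  have hy1 : σ y = 1 := by
    have h : ∀ a : ZMod 2, a ≠ 0 → a = 1 := by decide
    exact h _ hy
  have h1 : ∑ x, zmodSign (σ (x + y)) = ∑ x, zmodSign (σ x) :=
    Equiv.sum_comp (Equiv.addRight y) fun x => zmodSign (σ x)
  simp only [map_add, zmodSign_add, ← Finset.sum_mul, hy1] at h1
  rw [zmodSign, if_pos rfl] at h1
  linarith

lemma sum_zmodSign_nonneg (σ : X →+ ZMod 2) : 0 ≤ ∑ x, zmodSign (σ x) := by
  by_cases h : σ = 0
  · simp [h, zmodSign]
  · exact (sum_zmodSign_eq_zero σ h).ge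

/-- Odd cuts make up at most half of all cuts. -/
lemma sum_neg_one_pow_card_cutEdges_nonneg (S : Finset ι) :
    (0 : ℝ) ≤ ∑ x, (-1) ^ (cutEdges ℓ S x).card := by
  simp only [← zmodSign_natCast, card_cutEdges_cast]
  exact sum_zmodSign_nonneg _

lemma sum_first_moment (hne : ∀ e, ℓ e ≠ 0) (S : Finset ι) :
    ∑ x, ((S.card : ℝ) - 2 * (cutEdges ℓ S x).card) = 0 := by
  simp only [← sum_zmodSign]
  rw [Finset.sum_comm]
  exact Finset.sum_eq_zero fun e _ => sum_zmodSign_eq_zero _ (hne e)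

lemma sum_second_moment (hinj : Function.Injective ℓ) (S : Finset ι) :
    ∑ x, ((S.card : ℝ) - 2 * (cutEdges ℓ S x).card) ^ 2 = (Fintype.card X : ℝ) * S.card := by
  classical
  simp only [← sum_zmodSign, sq, Finset.sum_mul_sum, ← zmodSign_add]
  rw [Finset.sum_comm]
  have h : ∀ e ∈ S, ∑ x, ∑ e' ∈ S, zmodSign (ℓ e x + ℓ e' x) = Fintype.card X := by
    intro e he
    rw [Finset.sum_comm, Finset.sum_eq_single e]
    · have h2 : ∀ a : ZMod 2, a + a = 0 := by decide
      simp [h2, zmodSign]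
    · intro e' _ hne
      refine sum_zmodSign_eq_zero (ℓ e + ℓ e') fun h0 => hne (hinj ?_)
      ext x
      have h3 : ∀ a b : ZMod 2, a + b = 0 → b = a := by decide
      exact h3 _ _ (DFunLike.congr_fun h0 x)
    · exact fun h => absurd he h
  rw [Finset.sum_congr rfl h, Finset.sum_const, nsmul_eq_mul, mul_comm]

lemma exists_bridgeless_subset [DecidableEq ι] (S : Finset ι) :
    ∃ R ⊆ S, Bridgeless ℓ R ∧ ∀ ψ : ℕ → ℝ, ∑ x, ψ (cutEdges ℓ S x).card
      = ∑ x, (bridgeAvg^[S.card - R.card] ψ) (cutEdges ℓ R x).card := by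
  induction S using Finset.strongInduction with
  | H S ih =>
    by_cases hS : Bridgeless ℓ S
    · exact ⟨S, subset_rfl, hS, fun ψ => by simp⟩
    · obtain ⟨y, hy⟩ : ∃ y, (cutEdges ℓ S y).card = 1 := by
        simpa [Bridgeless] using hS
      obtain ⟨e, he⟩ := Finset.card_eq_one.mp hy
      have heS : e ∈ S ∧ ℓ e y = 1 := by
        have : e ∈ cutEdges ℓ S y := by simp [he]
        simpa [cutEdges] using this
      have hoth : ∀ e' ∈ S.erase e, ℓ e' y = 0 := by
        intro e' he'
        rw [Finset.mem_erase] at he'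
        have h01 : ∀ a : ZMod 2, a ≠ 1 → a = 0 := by decide
        refine h01 _ fun h1 => he'.1 ?_
        have : e' ∈ cutEdges ℓ S y := by simp [cutEdges, he'.2, h1]
        simpa [he] using this
      obtain ⟨R, hRS, hR, hψ⟩ := ih (S.erase e) (Finset.erase_ssubset heS.1)
      refine ⟨R, hRS.trans (Finset.erase_subset _ _), hR, fun ψ => ?_⟩
      have hcard : S.card - R.card = (S.erase e).card - R.card + 1 := by
        have h1 := Finset.card_le_card hRS
        have h2 := Finset.card_erase_add_one heS.1
        omega
      rw [hcard, Function.iterate_succ, Function.comp, ← hψ]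
      have hcut : ∀ x, (cutEdges ℓ S x).card
          = (cutEdges ℓ (S.erase e) x).card + if ℓ e x = 1 then 1 else 0 := by
        intro x
        simp only [cutEdges, Finset.card_filter]
        rw [← Finset.add_sum_erase S _ heS.1, add_comm]
      have hshift : ∀ x, cutEdges ℓ (S.erase e) (x + y) = cutEdges ℓ (S.erase e) x := by
        intro x
        refine Finset.filter_congr fun e' he' => ?_
        rw [map_add, hoth e' he', add_zero]
      have h1 : ∑ x, ψ (cutEdges ℓ S (x + y)).card = ∑ x, ψ (cutEdges ℓ S x).card :=
        Equiv.sum_comp (Equiv.addRight y) fun x => ψ (cutEdges ℓ S x).card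
      have h2 : ∀ x, ψ (cutEdges ℓ S x).card + ψ (cutEdges ℓ S (x + y)).card
          = 2 * bridgeAvg ψ (cutEdges ℓ (S.erase e) x).card := by
        intro x
        rw [hcut, hcut (x + y), hshift, map_add, heS.2, bridgeAvg]
        by_cases hx : ℓ e x = 1
        · rw [if_pos hx, if_neg fun h => (zmod_two_add_one_eq_one _).mp h hx, add_zero]; ring
        · rw [if_neg hx, if_pos ((zmod_two_add_one_eq_one _).mpr hx), add_zero]; ring
      have h3 := Finset.sum_congr (s₁ := Finset.univ) rfl fun x _ => h2 x
      rw [Finset.sum_add_distrib, h1, ← Finset.mul_sum] at h3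
      linarith

/-- The number of points cutting exactly `k` edges of `S`. -/
def cutCount (S : Finset ι) (k : ℕ) : ℕ :=
  (Finset.univ.filter fun x => (cutEdges ℓ S x).card = k).card

lemma sum_cutEdges_eq (S : Finset ι) (N : ℕ) (hN : S.card < N) (ψ : ℕ → ℝ) :
    ∑ x, ψ (cutEdges ℓ S x).card = ∑ k ∈ Finset.range N, cutCount ℓ S k * ψ k := by
  rw [← Finset.sum_fiberwise_of_maps_to (t := Finset.range N)
    (g := fun x => (cutEdges ℓ S x).card)]
  · refine Finset.sum_congr rfl fun k _ => ?_
    rw [Finset.sum_congr rfl (g := fun _ => ψ k) fun x hx => by rw [(Finset.mem_filter.mp hx).2],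
      Finset.sum_const, nsmul_eq_mul, cutCount]
  · intro x _
    exact Finset.mem_range.mpr ((Finset.card_filter_le _ _).trans_lt hN)

lemma card_mul_cutCount_zero_le (hinj : Function.Injective ℓ) (S : Finset ι) :
    S.card * cutCount ℓ S 0 ≤ Fintype.card X := by
  rcases Nat.eq_zero_or_pos S.card with h0 | hpos
  · simp [h0]
  have h := sum_second_moment ℓ hinj S
  have h1 : (cutCount ℓ S 0 : ℝ) * (S.card : ℝ) ^ 2 ≤ Fintype.card X * S.card := by
    rw [← h, cutCount, ← nsmul_eq_mul, ← Finset.sum_const]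
    refine (Finset.sum_le_sum fun x hx => ?_).trans
      (Finset.sum_le_sum_of_subset_of_nonneg (Finset.filter_subset _ _) fun x _ _ => sq_nonneg _)
    rw [(Finset.mem_filter.mp hx).2]; simp
  have h2 : (S.card : ℝ) * cutCount ℓ S 0 ≤ Fintype.card X := by
    have : (0 : ℝ) < S.card := by exact_mod_cast hpos
    nlinarith
  exact_mod_cast h2

lemma cutCount_zero_pos (S : Finset ι) : 0 < cutCount ℓ S 0 :=
  Finset.card_pos.mpr ⟨0, by simp [cutEdges]⟩

/-- The points cutting no edge form a subgroup. -/
lemma cutCount_zero_dvd (S : Finset ι) : cutCount ℓ S 0 ∣ Fintype.card X := by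
  let K : AddSubgroup X := ⨅ e ∈ S, (ℓ e).ker
  have hK : Nat.card K = cutCount ℓ S 0 := by
    refine Nat.subtype_card _ fun x => ?_
    have h01 : ∀ a : ZMod 2, a ≠ 1 ↔ a = 0 := by decide
    simp [K, cutEdges, AddSubgroup.mem_iInf, AddMonoidHom.mem_ker, Finset.filter_eq_empty_iff, h01]
  rw [← hK, ← Nat.card_eq_fintype_card]
  exact AddSubgroup.card_addSubgroup_dvd_card K

lemma sum_four_values (S : Finset ι) (c₀ c₁ c₂ c₃ : ℝ) :
    ∑ x, (fun k : ℕ => if k = 0 then c₀ else if k = 1 then c₁ else if k = 2 then c₂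
      else if k = 3 then c₃ else 0) (cutEdges ℓ S x).card
    = c₀ * cutCount ℓ S 0 + c₁ * cutCount ℓ S 1 + c₂ * cutCount ℓ S 2
      + c₃ * cutCount ℓ S 3 := by
  simp only [cutCount, Finset.card_filter, Nat.cast_sum, Finset.mul_sum,
    ← Finset.sum_add_distrib]
  refine Finset.sum_congr rfl fun x _ => ?_
  generalize (cutEdges ℓ S x).card = k
  rcases k with _ | _ | _ | _ | k <;> simp

lemma cutCount_add_le (S : Finset ι) :
    (cutCount ℓ S 0 : ℝ) + cutCount ℓ S 1 + cutCount ℓ S 2 + cutCount ℓ S 3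
      ≤ Fintype.card X := by
  have h := sum_four_values ℓ S 1 1 1 1
  simp only [one_mul] at h
  rw [← h, Fintype.card_eq_sum_ones, Nat.cast_sum]
  refine Finset.sum_le_sum fun x _ => ?_
  split_ifs <;> norm_num

lemma Bridgeless.cutCount_one {S : Finset ι} (hS : Bridgeless ℓ S) : cutCount ℓ S 1 = 0 := by
  rw [cutCount, Finset.card_eq_zero, Finset.filter_eq_empty_iff]
  exact fun x _ => hS x

lemma sum_cutWeight_le (S : Finset ι) :
    ∑ x, cutWeight (cutEdges ℓ S x).card
      ≤ 28 * (cutCount ℓ S 0 : ℝ) + 3 / 2 * Fintype.card X := by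
  have h := sum_neg_one_pow_card_cutEdges_nonneg ℓ S
  have h1 : ∑ x, cutWeight (cutEdges ℓ S x).card
      ≤ ∑ x, ((if (cutEdges ℓ S x).card = 0 then (28 : ℝ) else 0)
        + (3 / 2 - 3 / 2 * (-1) ^ (cutEdges ℓ S x).card)) := by
    refine Finset.sum_le_sum fun x _ => ?_
    generalize (cutEdges ℓ S x).card = k
    rcases k with _ | _ | _ | _ | k
    · norm_num [cutWeight]
    · norm_num [cutWeight]
    · norm_num [cutWeight]
    · norm_num [cutWeight]
    · have h0 : cutWeight (k + 1 + 1 + 1 + 1) = 0 := by simp [cutWeight]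
      rw [h0]
      rcases neg_one_pow_eq_or ℝ (k + 1 + 1 + 1 + 1) with h | h <;> rw [h] <;> norm_num
  refine h1.trans ?_
  rw [Finset.sum_add_distrib, Finset.sum_sub_distrib, ← Finset.mul_sum, Finset.sum_const,
    ← Finset.sum_filter, Finset.sum_const, nsmul_eq_mul, nsmul_eq_mul, Finset.card_univ, cutCount]
  linarith

/-- The bound for bridgeless sets of odd size, where the triangle and the rank three sets of five
edges are extremal. -/
lemma Bridgeless.sum_cutWeight_le {d : ℕ} (hX : Fintype.card X = 2 ^ d)
    (hinj : Function.Injective ℓ) (hne : ∀ e, ℓ e ≠ 0) {S : Finset ι} (hS : Bridgeless ℓ S)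
    (hodd : Odd S.card) :
    ∑ x, cutWeight (cutEdges ℓ S x).card ≤ 4 * (Fintype.card X : ℝ) ∧
      (∑ x, cutWeight (cutEdges ℓ S x).card = 4 * (Fintype.card X : ℝ) →
        S.card ≤ 3 ∨ (S.card = 5 ∧ 8 * cutCount ℓ S 0 = Fintype.card X ∧
          0 < cutCount ℓ S 4)) := by
  have hle := card_mul_cutCount_zero_le ℓ hinj S
  have hpos := cutCount_zero_pos ℓ S
  have hpos' : (0 : ℝ) < cutCount ℓ S 0 := by exact_mod_cast hpos
  obtain ⟨r, hr⟩ : ∃ r, Fintype.card X = cutCount ℓ S 0 * 2 ^ r := by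
    obtain ⟨c, hc⟩ := cutCount_zero_dvd ℓ S
    have h2 : c ∣ 2 ^ d := ⟨cutCount ℓ S 0, by rw [← hX, hc, mul_comm]⟩
    obtain ⟨r, -, rfl⟩ := (Nat.dvd_prime_pow Nat.prime_two).mp h2
    exact ⟨r, hc⟩
  have hone := hS.cutCount_one
  by_cases hr4 : 4 ≤ r
  · have h16 : 16 * cutCount ℓ S 0 ≤ Fintype.card X := by
      have : 2 ^ 4 ≤ 2 ^ r := Nat.pow_le_pow_right (by norm_num) hr4
      rw [hr]; nlinarith
    have h16' : 16 * (cutCount ℓ S 0 : ℝ) ≤ Fintype.card X := by exact_mod_cast h16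
    have h := _root_.sum_cutWeight_le ℓ S
    exact ⟨by linarith, fun h' => by linarith⟩
  · have hN : S.card ≤ 2 ^ r := by
      rw [hr, mul_comm] at hle
      exact Nat.le_of_mul_le_mul_left hle hpos
    have hval := sum_cutEdges_eq ℓ S (S.card + 1) (Nat.lt_succ_self _)
    have e1 := hval cutWeight
    have e2 := hval fun _ => 1
    have e3 := hval fun k => (S.card : ℝ) - 2 * k
    have e4 := hval fun k => ((S.card : ℝ) - 2 * k) ^ 2
    have e5 := hval fun k => (-1) ^ k
    have e6 := sum_neg_one_pow_card_cutEdges_nonneg ℓ S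
    rw [sum_first_moment ℓ hne] at e3
    rw [sum_second_moment ℓ hinj] at e4
    rw [e5] at e6
    rw [Finset.sum_const, nsmul_eq_mul, Finset.card_univ, mul_one] at e2
    rw [e1]
    clear hval e1 e5
    have hr' : (Fintype.card X : ℝ) = cutCount ℓ S 0 * 2 ^ r := by exact_mod_cast hr
    have hr8 : 2 ^ r ≤ 2 ^ 3 := Nat.pow_le_pow_right (by norm_num) (by omega)
    have hr5 : 5 ≤ S.card → r = 3 := by
      intro h5
      by_contra hr3
      have : 2 ^ r ≤ 2 ^ 2 := Nat.pow_le_pow_right (by norm_num) (by omega)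
      omega
    obtain ⟨i, hi⟩ := hodd
    have hi3 : i ≤ 3 := by omega
    interval_cases i <;> norm_num at hi <;> rw [hi] at e2 e3 e4 e6 ⊢ <;>
      simp only [Finset.sum_range_succ, Finset.sum_range_zero, cutWeight, hone] at e2 e3 e4 e6 ⊢ <;>
      norm_num at e2 e3 e4 e6 ⊢
    · linarith
    · linarith
    · obtain rfl := hr5 (by omega)
      norm_num at hr'
      have n5 : (0 : ℝ) ≤ cutCount ℓ S 5 := Nat.cast_nonneg _
      have h4 : (cutCount ℓ S 4 : ℝ) = cutCount ℓ S 0 := by linarith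
      refine ⟨by linarith, fun _ => ⟨by omega, ?_⟩⟩
      have : cutCount ℓ S 4 = cutCount ℓ S 0 := by exact_mod_cast h4
      omega
    · obtain rfl := hr5 (by omega)
      norm_num at hr'
      have n2 : (0 : ℝ) ≤ cutCount ℓ S 2 := Nat.cast_nonneg _
      have n3 : (0 : ℝ) ≤ cutCount ℓ S 3 := Nat.cast_nonneg _
      have n5 : (0 : ℝ) ≤ cutCount ℓ S 5 := Nat.cast_nonneg _
      have n6 : (0 : ℝ) ≤ cutCount ℓ S 6 := Nat.cast_nonneg _
      have n7 : (0 : ℝ) ≤ cutCount ℓ S 7 := Nat.cast_nonneg _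
      exact ⟨by linarith, fun h => by linarith⟩

lemma four_mul_cube_bound (m : ℕ) (hm : 2 ≤ m) :
    28 - 20 * (m : ℝ) - 2 * m * (m - 1) + m * (m - 1) * (m - 2) / 2 < 4 * 2 ^ m := by
  have h : ∀ k : ℕ, ((k : ℝ) + 2) * (k + 1) * k / 2 ≤ 4 * 2 ^ (k + 2) := by
    intro k
    rcases Nat.lt_or_ge k 5 with hk | hk
    · interval_cases k <;> norm_num
    · induction k, hk using Nat.le_induction with
      | base => norm_num
      | succ k hk ih =>
        have : (5 : ℝ) ≤ k := by exact_mod_cast hk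
        rw [show k + 1 + 2 = k + 2 + 1 by ring, pow_succ]
        push_cast
        have h1 : 0 ≤ ((k : ℝ) + 2) * (k + 1) * (k - 3) :=
          mul_nonneg (by positivity) (by linarith)
        nlinarith
  obtain ⟨k, rfl⟩ := Nat.exists_eq_add_of_le' hm
  have := h k
  push_cast
  have hk : (0 : ℝ) ≤ k := Nat.cast_nonneg k
  nlinarith

lemma cube_lower_bound (m : ℕ) :
    -92 ≤ 28 - 20 * (m : ℝ) - 2 * m * (m - 1) + m * (m - 1) * (m - 2) / 2 := by
  rcases Nat.lt_or_ge m 10 with hm | hm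
  · interval_cases m <;> norm_num
  · obtain ⟨k, rfl⟩ := Nat.exists_eq_add_of_le' hm
    push_cast
    have hk : (0 : ℝ) ≤ k := Nat.cast_nonneg k
    have : (0 : ℝ) ≤ k ^ 3 := by positivity
    nlinarith

/-- The spectral bound, together with the list of possible sizes of extremal sets. -/
lemma spectral_bound [DecidableEq ι] {d : ℕ} (hX : Fintype.card X = 2 ^ d)
    (hinj : Function.Injective ℓ) (hne : ∀ e, ℓ e ≠ 0) {S : Finset ι} (hS : S.Nonempty) :
    -4 * (Fintype.card X : ℝ) ≤ (-1) ^ S.card * ∑ x, cutWeight (cutEdges ℓ S x).card ∧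
      ((-1) ^ S.card * ∑ x, cutWeight (cutEdges ℓ S x).card = -4 * (Fintype.card X : ℝ) →
        S.card ≤ 3 ∨ (S.card = 4 ∧ 16 * cutCount ℓ S 0 = Fintype.card X ∧ 0 < cutCount ℓ S 4) ∨
          (S.card = 5 ∧ 8 * cutCount ℓ S 0 = Fintype.card X ∧ 0 < cutCount ℓ S 4)) := by
  obtain ⟨R, hRS, hR, hψ⟩ := exists_bridgeless_subset ℓ S
  obtain ⟨m, hm⟩ : ∃ m, S.card = R.card + m := Nat.exists_eq_add_of_le (Finset.card_le_card hRS)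
  have hm' : S.card - R.card = m := by omega
  rw [hm'] at hψ
  have hM : (0 : ℝ) < Fintype.card X := by rw [hX]; positivity
  have hsum := hψ cutWeight
  rw [bridgeAvg_iterate_cutWeight] at hsum
  simp only [← Finset.sum_div] at hsum
  rw [sum_four_values, hR.cutCount_one, Nat.cast_zero, mul_zero, add_zero] at hsum
  have hle := cutCount_add_le ℓ R
  rw [hR.cutCount_one, Nat.cast_zero, add_zero] at hle
  have ha0 : (0 : ℝ) < cutCount ℓ R 0 := by exact_mod_cast cutCount_zero_pos ℓ R
  have ha2 : (0 : ℝ) ≤ cutCount ℓ R 2 := Nat.cast_nonneg _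
  have ha3 : (0 : ℝ) ≤ cutCount ℓ R 3 := Nat.cast_nonneg _
  have hhalf : R.card ≠ 0 → 2 * (cutCount ℓ R 0 : ℝ) ≤ Fintype.card X := by
    intro h0
    have h1 : R.card ≠ 1 := by
      intro h1
      have h2 := sum_cutEdges_eq ℓ R 2 (by omega) fun k => (R.card : ℝ) - 2 * k
      rw [sum_first_moment ℓ hne, Finset.sum_range_succ, Finset.sum_range_one,
        hR.cutCount_one, h1] at h2
      norm_num at h2
      linarith
    have h2 := card_mul_cutCount_zero_le ℓ hinj R
    have h3 : 2 * cutCount ℓ R 0 ≤ Fintype.card X :=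
      le_trans (Nat.mul_le_mul_right _ (by omega)) h2
    exact_mod_cast h3
  rcases Nat.even_or_odd S.card with hev | hodd
  · rw [hev.neg_one_pow, one_mul, hsum]
    by_cases hm5 : 5 ≤ m
    · have h1 := cube_lower_bound m
      have h2 : (32 : ℝ) ≤ 2 ^ m := by
        have := pow_le_pow_right₀ (a := (2 : ℝ)) (by norm_num) hm5
        norm_num at this; exact this
      have h3 : (5 : ℝ) ≤ m := by exact_mod_cast hm5
      have key : -4 * (Fintype.card X : ℝ) < ((28 - 20 * (m : ℝ) - 2 * m * (m - 1)
          + m * (m - 1) * (m - 2) / 2) * cutCount ℓ R 0 + (3 * m - 4) * cutCount ℓ R 2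
          + 3 * cutCount ℓ R 3) / 2 ^ m := by
        rw [lt_div_iff₀ (by positivity)]
        have h4 : 0 ≤ (3 * (m : ℝ) - 4) * cutCount ℓ R 2 := mul_nonneg (by linarith) ha2
        have h5 := mul_le_mul_of_nonneg_right h1 ha0.le
        have h6 := mul_le_mul_of_nonneg_right h2 hM.le
        linarith
      exact ⟨key.le, fun h => absurd h key.ne'⟩
    · have h0 : S.card ≠ 0 := hS.card_pos.ne'
      have hm4 : m ≤ 4 := by omega
      interval_cases m
      · norm_num
        exact ⟨by linarith, fun h => by linarith⟩
      · norm_num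
        exact ⟨by linarith, fun h => by linarith⟩
      · norm_num
        refine ⟨by linarith, fun h => ?_⟩
        by_cases hR0 : R.card = 0
        · left; omega
        · linarith [hhalf hR0]
      · norm_num
        have hR0 : R.card ≠ 0 := by
          intro h; rw [hm, h] at hev; exact absurd hev (by decide)
        exact ⟨by linarith [hhalf hR0], fun h => by linarith [hhalf hR0]⟩
      · norm_num
        refine ⟨by linarith, fun h => ?_⟩
        by_cases hR0 : R.card = 0
        · right; left
          have h1 := hψ fun k => if k = 0 then 16 else 0
          have h2 := hψ fun k => if k = 4 then 16 else 0
          have h3 : ∀ x, (cutEdges ℓ R x).card = 0 := fun x =>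
            Nat.le_zero.mp ((Finset.card_filter_le _ _).trans hR0.le)
          simp only [h3, Finset.sum_const, nsmul_eq_mul, Finset.card_univ, ← Finset.sum_filter,
            ← cutCount.eq_1] at h1 h2
          norm_num [Function.iterate_succ, bridgeAvg] at h1 h2
          refine ⟨by omega, ?_, ?_⟩
          · rw [mul_comm]
            exact_mod_cast h1
          · have h4 : (0 : ℝ) < cutCount ℓ S 4 := by linarith
            exact_mod_cast h4
        · linarith [hhalf hR0]
  · rw [hodd.neg_one_pow]
    suffices hs : ∑ x, cutWeight (cutEdges ℓ S x).card ≤ 4 * (Fintype.card X : ℝ) ∧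
        (∑ x, cutWeight (cutEdges ℓ S x).card = 4 * (Fintype.card X : ℝ) →
          S.card ≤ 3 ∨ (S.card = 5 ∧ 8 * cutCount ℓ S 0 = Fintype.card X ∧
            0 < cutCount ℓ S 4)) by
      refine ⟨by linarith [hs.1], fun h => ?_⟩
      rcases hs.2 (by linarith) with h | h
      · exact Or.inl h
      · exact Or.inr (Or.inr h)
    by_cases hm0 : m = 0
    · have hRS' : R = S := Finset.eq_of_subset_of_card_le hRS (by omega)
      subst hRS'
      exact hR.sum_cutWeight_le ℓ hX hinj hne hodd
    rw [hsum]
    by_cases hm1 : m = 1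
    · subst hm1
      norm_num
      refine ⟨by linarith, fun h => ?_⟩
      by_cases hR0 : R.card = 0
      · left; omega
      · linarith [hhalf hR0]
    · have hm2 : 2 ≤ m := by omega
      have h1 := four_mul_cube_bound m hm2
      have h2 : 3 * (m : ℝ) - 4 < 4 * 2 ^ m := by
        have : (m : ℝ) < 2 ^ m := by exact_mod_cast Nat.lt_two_pow_self
        linarith
      have h3 : (1 : ℝ) ≤ 2 ^ m := one_le_pow₀ (by norm_num)
      have key : ((28 - 20 * (m : ℝ) - 2 * m * (m - 1)
          + m * (m - 1) * (m - 2) / 2) * cutCount ℓ R 0 + (3 * m - 4) * cutCount ℓ R 2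
          + 3 * cutCount ℓ R 3) / 2 ^ m < 4 * (Fintype.card X : ℝ) := by
        rw [div_lt_iff₀ (by positivity)]
        have h4 := mul_lt_mul_of_pos_right h1 ha0
        have h5 := mul_le_mul_of_nonneg_right h2.le ha2
        have h6 : 3 * (cutCount ℓ R 3 : ℝ) ≤ 4 * 2 ^ m * cutCount ℓ R 3 :=
          mul_le_mul_of_nonneg_right (by linarith) ha3
        have h7 : (4 * 2 ^ m) * ((cutCount ℓ R 0 : ℝ) + cutCount ℓ R 2 + cutCount ℓ R 3)
            ≤ (4 * 2 ^ m) * Fintype.card X := mul_le_mul_of_nonneg_left hle (by positivity)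
        linarith
      exact ⟨key.le, fun h => absurd h key.ne⟩

end CutStatistics

section Extremal

variable {ι : Type*} [DecidableEq ι] [Fintype ι]

/-- The indicator function of a family of sets. -/
def familyIndicator (F : Finset (Finset ι)) (G : Finset ι) : ℝ := if G ∈ F then 1 else 0

lemma walshCoeff_familyIndicator_empty (F : Finset (Finset ι)) :
    walshCoeff (familyIndicator F) ∅ = F.card / 2 ^ Fintype.card ι := by
  simp [walshCoeff, walsh, familyIndicator]

lemma sum_walshCoeff_familyIndicator_sq (F : Finset (Finset ι)) :
    ∑ S, walshCoeff (familyIndicator F) S ^ 2 = F.card / 2 ^ Fintype.card ι := by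
  have h := sum_walshCoeff_sq_mul_walsh (familyIndicator F) ∅
  have h1 : ∀ S : Finset ι, walsh S ∅ = 1 := fun S => by simp [walsh]
  have h2 : ∀ G : Finset ι, symmDiff G ∅ = G := fun G => symmDiff_bot G
  simp only [h1, h2, mul_one] at h
  rw [h]
  simp [familyIndicator]

/-- If an up-set depends on the coordinate `e` and has minimal measure for its Walsh degree, then
all its members contain `e`. -/
lemma mem_of_walshCoeff_ne_zero {F : Finset (Finset ι)} {d : ℕ}
    (hup : IsUpperSet (F : Set (Finset ι))) (hcard : 2 ^ d * F.card = 2 ^ Fintype.card ι)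
    (hdeg : ∀ S, walshCoeff (familyIndicator F) S ≠ 0 → S.card ≤ d)
    {e : ι} {S₀ : Finset ι} (hS₀ : walshCoeff (familyIndicator F) S₀ ≠ 0) (he₀ : e ∈ S₀)
    {G : Finset ι} (hG : G ∈ F) : e ∈ G := by
  obtain ⟨S, hS, hmax⟩ := Finset.exists_max_image
    (Finset.univ.filter fun S => walshCoeff (familyIndicator F) S ≠ 0 ∧ e ∈ S) Finset.card
    ⟨S₀, by simp [hS₀, he₀]⟩
  simp only [Finset.mem_filter, Finset.mem_univ, true_and] at hS hmax
  have hmax' : ∀ S', S ⊂ S' → walshCoeff (familyIndicator F) S' = 0 := by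
    intro S' hSS'
    by_contra h
    have h1 := hmax S' ⟨h, hSS'.1 hS.2⟩
    have h2 := Finset.card_lt_card hSS'
    omega
  have hpiv : ∀ B, ∃ A ⊆ S, symmDiff B A ∈ F.filter (e ∈ ·) := by
    intro B
    by_contra! hno
    refine sum_powerset_walsh_mul_ne_zero _ S hS.1 hmax' B ?_
    have hsame : ∀ A ⊆ S, familyIndicator F (symmDiff B A)
        = familyIndicator F (symmDiff B (symmDiff A {e})) := by
      have hzero : ∀ A ⊆ S, e ∈ symmDiff B A → familyIndicator F (symmDiff B A) = 0 ∧
          familyIndicator F (symmDiff B (symmDiff A {e})) = 0 := by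
        intro A hA he
        have h1 : symmDiff B A ∉ F := fun h => hno A hA (Finset.mem_filter.mpr ⟨h, he⟩)
        have h2 : symmDiff B (symmDiff A {e}) ∉ F := by
          intro h
          refine h1 (hup ?_ h)
          intro e' he'
          by_cases hee : e' = e
          · rw [hee]; exact he
          · simpa [Finset.mem_symmDiff, hee] using he'
        exact ⟨if_neg h1, if_neg h2⟩
      intro A hA
      by_cases he : e ∈ symmDiff B A
      · rw [(hzero A hA he).1, (hzero A hA he).2]
      · have hA' : symmDiff A {e} ⊆ S := by
          intro e' he'
          rw [Finset.mem_symmDiff, Finset.mem_singleton] at he'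
          rcases he' with h | h
          · exact hA h.1
          · rw [h.1]; exact hS.2
        have he' : e ∈ symmDiff B (symmDiff A {e}) := by
          simp only [Finset.mem_symmDiff, Finset.mem_singleton] at he ⊢
          tauto
        have := hzero _ hA' he'
        rw [symmDiff_assoc, symmDiff_self, symmDiff_bot] at this
        rw [this.1, this.2]
    have hflip : ∀ A, walsh (symmDiff A {e}) S = - walsh A S := by
      intro A
      rw [walsh_comm, walsh_symmDiff, walsh_comm S A, walsh_comm S {e}]
      simp [walsh, hS.2]
    refine Finset.sum_involution (fun A _ => symmDiff A {e}) ?_ ?_ ?_ ?_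
    · intro A hA
      rw [hflip, ← hsame A (Finset.mem_powerset.mp hA)]; ring
    · intro A _ _ h
      have : symmDiff A {e} = A := h
      rw [symmDiff_eq_left] at this
      simp at this
    · intro A hA
      rw [Finset.mem_powerset] at hA ⊢
      intro e' he'
      rw [Finset.mem_symmDiff, Finset.mem_singleton] at he'
      rcases he' with h | h
      · exact hA h.1
      · rw [h.1]; exact hS.2
    · intro A _
      rw [symmDiff_assoc, symmDiff_self, symmDiff_bot]
  have hcount : 2 ^ Fintype.card ι ≤ (F.filter (e ∈ ·)).card * 2 ^ S.card := by
    rw [← Finset.card_powerset, ← Finset.card_product, ← Fintype.card_finset, ← Finset.card_univ]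
    refine Finset.card_le_card_of_surjOn (fun q => symmDiff q.1 q.2) ?_
    intro B _
    obtain ⟨A, hA, hBA⟩ := hpiv B
    refine ⟨(symmDiff B A, A), ?_, ?_⟩
    · simp only [Finset.coe_product, Set.mem_prod, Finset.mem_coe, Finset.mem_powerset]
      exact ⟨hBA, hA⟩
    · simp only [symmDiff_assoc, symmDiff_self, symmDiff_bot]
  have hle : F.card ≤ (F.filter (e ∈ ·)).card := by
    have h1 : 2 ^ S.card ≤ 2 ^ d := Nat.pow_le_pow_right (by norm_num) (hdeg S hS.1)
    have h2 : 2 ^ d * F.card ≤ 2 ^ d * (F.filter (e ∈ ·)).card := by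
      rw [hcard, mul_comm]
      exact hcount.trans (Nat.mul_le_mul_left _ h1)
    exact Nat.le_of_mul_le_mul_left h2 (by positivity)
  have hEq := Finset.eq_of_subset_of_card_le (Finset.filter_subset (e ∈ ·) F) hle
  rw [← hEq] at hG
  exact (Finset.mem_filter.mp hG).2

lemma card_filter_superset (T : Finset ι) :
    (Finset.univ.filter (T ⊆ ·)).card * 2 ^ T.card = 2 ^ Fintype.card ι := by
  have h : Finset.univ.filter (T ⊆ ·) = Finset.Icc T Finset.univ := by
    ext G; simp
  rw [h, Finset.card_Icc_finset (Finset.subset_univ T), ← pow_add, Finset.card_univ,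
    Nat.sub_add_cancel (Finset.card_le_univ T)]

/-- An up-set of Walsh degree at most `d` and measure `2⁻ᵈ` is a principal filter. -/
lemma exists_forall_mem_iff_subset {F : Finset (Finset ι)} {d : ℕ}
    (hup : IsUpperSet (F : Set (Finset ι))) (hcard : 2 ^ d * F.card = 2 ^ Fintype.card ι)
    (hdeg : ∀ S, walshCoeff (familyIndicator F) S ≠ 0 → S.card ≤ d) :
    ∃ T : Finset ι, T.card = d ∧ ∀ G, G ∈ F ↔ T ⊆ G := by
  let T := Finset.univ.filter fun e => ∃ S, walshCoeff (familyIndicator F) S ≠ 0 ∧ e ∈ S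
  have hT : ∀ G ∈ F, T ⊆ G := by
    intro G hG e he
    obtain ⟨S, hS, heS⟩ := (Finset.mem_filter.mp he).2
    exact mem_of_walshCoeff_ne_zero hup hcard hdeg hS heS hG
  have hdep : ∀ G, T ⊆ G → familyIndicator F G = familyIndicator F T := by
    intro G hG
    rw [← sum_walshCoeff_mul_walsh (familyIndicator F) G,
      ← sum_walshCoeff_mul_walsh (familyIndicator F) T]
    refine Finset.sum_congr rfl fun S _ => ?_
    by_cases hS : walshCoeff (familyIndicator F) S = 0
    · rw [hS, zero_mul, zero_mul]
    · have hST : S ⊆ T := fun e he => Finset.mem_filter.mpr ⟨Finset.mem_univ _, S, hS, he⟩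
      rw [walsh_eq_pow, walsh_eq_pow, Finset.inter_eq_left.mpr hST,
        Finset.inter_eq_left.mpr (hST.trans hG)]
  obtain ⟨G₀, hG₀⟩ : F.Nonempty := by
    rw [← Finset.card_pos]
    refine Nat.pos_of_mul_pos_left (a := 2 ^ d) ?_
    rw [hcard]; positivity
  have hmem : ∀ G, T ⊆ G → (G ∈ F ↔ T ∈ F) := by
    intro G hG
    have := hdep G hG
    unfold familyIndicator at this
    by_cases h1 : G ∈ F <;> by_cases h2 : T ∈ F <;> simp_all
  have hTF : T ∈ F := (hmem G₀ (hT G₀ hG₀)).mp hG₀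
  have hiff : ∀ G, G ∈ F ↔ T ⊆ G := fun G => ⟨hT G, fun h => hup h hTF⟩
  refine ⟨T, ?_, hiff⟩
  have h1 := card_filter_superset T
  have h2 : Finset.univ.filter (T ⊆ ·) = F := by
    ext G; simp [hiff]
  rw [h2, ← hcard, mul_comm] at h1
  have hF0 : 0 < F.card := Finset.card_pos.mpr ⟨_, hG₀⟩
  exact Nat.pow_right_injective le_rfl (Nat.eq_of_mul_eq_mul_right hF0 h1)

/-- The uniform measure case: an up-set of sets whose pairwise intersections are never contained
in a cut has density at most one eighth, with equality only for principal filters. -/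
theorem eight_mul_card_le_of_cut_intersecting {X : Type*} [AddCommGroup X] [Fintype X] {d : ℕ}
    (hX : Fintype.card X = 2 ^ d) (ℓ : ι → X →+ ZMod 2) (hinj : Function.Injective ℓ)
    (hne : ∀ e, ℓ e ≠ 0) {F : Finset (Finset ι)} (hup : IsUpperSet (F : Set (Finset ι)))
    (hF : ∀ G ∈ F, ∀ H ∈ F, ∀ x, ∃ e ∈ G ∩ H, ℓ e x = 0) :
    8 * F.card ≤ 2 ^ Fintype.card ι ∧
      (8 * F.card = 2 ^ Fintype.card ι → ∃ T : Finset ι, T.card = 3 ∧ ∀ G, G ∈ F ↔ T ⊆ G) := by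
  set c := walshCoeff (familyIndicator F) with hc
  obtain ⟨M, hMdef⟩ : ∃ M : ℝ, M = Fintype.card X := ⟨_, rfl⟩
  have hM : 0 < M := by rw [hMdef, hX]; positivity
  have htrace : ∀ g : Finset ι → ℝ,
      ∑ S, c S ^ 2 * ((-1) ^ S.card * ∑ x, g (cutEdges ℓ S x)) = 0 := by
    intro g
    simp only [Finset.mul_sum]
    rw [Finset.sum_comm]
    refine Finset.sum_eq_zero fun x _ => ?_
    have h := sum_walshCoeff_sq_mul_trace (familyIndicator F) (cutEdges ℓ Finset.univ x) ?_ g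
    · rw [← h]
      refine Finset.sum_congr rfl fun S _ => ?_
      congr 3
      ext e; simp [cutEdges]
    · intro A hA G
      by_contra h
      obtain ⟨h1, h2⟩ := mul_ne_zero_iff.mp h
      have h1' : G ∈ F := by by_contra h; exact h1 (if_neg h)
      have h2' : symmDiff G Aᶜ ∈ F := by by_contra h; exact h2 (if_neg h)
      obtain ⟨e, he, he0⟩ := hF _ h1' _ h2' x
      have heA : e ∈ A := by
        simp only [Finset.mem_inter, Finset.mem_symmDiff, Finset.mem_compl] at he
        tauto
      have he1 := (Finset.mem_filter.mp (hA heA)).2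
      rw [he0] at he1
      exact absurd he1 (by decide)
  set α : ℝ := F.card / 2 ^ Fintype.card ι with hα
  have hc0 : c ∅ = α := walshCoeff_familyIndicator_empty F
  have hcsq : ∑ S, c S ^ 2 = α := sum_walshCoeff_familyIndicator_sq F
  have hα0 : 0 ≤ α := by positivity
  set lam : Finset ι → ℝ := fun S => (-1) ^ S.card * ∑ x, cutWeight (cutEdges ℓ S x).card
  have hlam0 : lam ∅ = 28 * M := by
    simp [lam, cutEdges, cutWeight, hMdef, mul_comm]
  have hlam : ∀ S : Finset ι, S.Nonempty → 0 ≤ lam S + 4 * M := fun S hS => by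
    have h := (spectral_bound ℓ hX hinj hne hS).1
    rw [← hMdef] at h
    linarith
  have hsum : ∑ S, c S ^ 2 * (lam S + 4 * M) = 4 * M * α := by
    have h := htrace fun S => cutWeight S.card
    simp only [mul_add, Finset.sum_add_distrib, ← Finset.sum_mul, hcsq]
    rw [show ∑ S, c S ^ 2 * lam S = 0 from h]; ring
  rw [← Finset.add_sum_erase _ _ (Finset.mem_univ ∅), hc0, hlam0] at hsum
  have hnn : ∀ S ∈ Finset.univ.erase ∅, 0 ≤ c S ^ 2 * (lam S + 4 * M) := by
    intro S hS
    exact mul_nonneg (sq_nonneg _)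
      (hlam S (Finset.nonempty_iff_ne_empty.mpr (Finset.ne_of_mem_erase hS)))
  have hrest := Finset.sum_nonneg hnn
  have hquad : 8 * α ^ 2 ≤ α := by nlinarith
  have hα8 : 8 * α ≤ 1 := by
    by_contra! h
    nlinarith
  have hcast : 8 * α * 2 ^ Fintype.card ι = 8 * F.card := by rw [hα]; field_simp
  refine ⟨?_, fun heq => ?_⟩
  · have h : (8 * F.card : ℝ) ≤ 2 ^ Fintype.card ι := by
      rw [← hcast]
      exact mul_le_of_le_one_left (by positivity) hα8
    exact_mod_cast h
  have hα1 : 8 * α = 1 := by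
    have h : (8 * F.card : ℝ) = 2 ^ Fintype.card ι := by exact_mod_cast heq
    rw [hα]; field_simp; linarith
  have hzero : ∑ S ∈ Finset.univ.erase ∅, c S ^ 2 * (lam S + 4 * M) = 0 := by
    have : α = 1 / 8 := by linarith
    rw [this] at hsum
    linarith
  have htight : ∀ S, c S ≠ 0 → S.card ≤ 3 ∨ (S.card = 4 ∧ 16 * cutCount ℓ S 0 = Fintype.card X ∧
      0 < cutCount ℓ S 4) ∨
      (S.card = 5 ∧ 8 * cutCount ℓ S 0 = Fintype.card X ∧ 0 < cutCount ℓ S 4) := by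
    intro S hS
    rcases S.eq_empty_or_nonempty with rfl | hSne
    · left; simp
    · refine (spectral_bound ℓ hX hinj hne hSne).2 ?_
      have h := (Finset.sum_eq_zero_iff_of_nonneg hnn).mp hzero S
        (Finset.mem_erase.mpr ⟨hSne.ne_empty, Finset.mem_univ _⟩)
      rcases mul_eq_zero.mp h with h | h
      · exact absurd (pow_eq_zero_iff two_ne_zero |>.mp h) hS
      · rw [← hMdef]; linarith
  -- If all supersets of a trace `H` of `S` in the Walsh support have one parity, `S` is not in it.
  have hkill : ∀ (H S : Finset ι) (ε : ℝ), (∃ x, cutEdges ℓ S x = H) →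
      (∀ S', c S' ≠ 0 → H ⊆ S' → (-1) ^ S'.card = ε) → c S = 0 := by
    intro H S ε hxS hε
    by_contra hS
    have hHS : H ⊆ S := by
      obtain ⟨x, hx⟩ := hxS
      rw [← hx]; exact Finset.filter_subset _ _
    have hε0 : ε ≠ 0 := by
      rw [← hε S hS hHS]; exact pow_ne_zero _ (by norm_num)
    have h := htrace fun S' => if S' = H then 1 else 0
    have h1 : ∀ S', c S' ^ 2 * ((-1) ^ S'.card * ∑ x, if cutEdges ℓ S' x = H then (1 : ℝ) else 0)
        = ε * (c S' ^ 2 * ∑ x, if cutEdges ℓ S' x = H then (1 : ℝ) else 0) := by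
      intro S'
      by_cases hc' : c S' = 0
      · simp [hc']
      · by_cases hHS' : H ⊆ S'
        · rw [hε S' hc' hHS']; ring
        · rw [Finset.sum_eq_zero]
          · simp
          · intro x _
            rw [if_neg]
            rintro rfl
            exact hHS' (Finset.filter_subset _ _)
    simp only [h1] at h
    rw [← Finset.mul_sum] at h
    have h2 := (mul_eq_zero.mp h).resolve_left hε0
    rw [Finset.sum_eq_zero_iff_of_nonneg] at h2
    · obtain ⟨x, hx⟩ := hxS
      rcases mul_eq_zero.mp (h2 S (Finset.mem_univ _)) with h3 | h3
      · exact hS (pow_eq_zero_iff two_ne_zero |>.mp h3)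
      · rw [Finset.sum_eq_zero_iff_of_nonneg (fun _ _ => by split_ifs <;> norm_num)] at h3
        have := h3 x (Finset.mem_univ _)
        rw [if_pos hx] at this
        norm_num at this
    · intro S' _
      exact mul_nonneg (sq_nonneg _)
        (Finset.sum_nonneg fun _ _ => by split_ifs <;> norm_num)
  have htrace4 : ∀ S : Finset ι, 0 < cutCount ℓ S 4 → ∃ x, (cutEdges ℓ S x).card = 4 := by
    intro S hS
    obtain ⟨x, hx⟩ := Finset.card_pos.mp hS
    exact ⟨x, (Finset.mem_filter.mp hx).2⟩
  have hfive : ∀ S, c S ≠ 0 → S.card ≠ 5 := by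
    intro S hS h5
    obtain ⟨h8, hpos⟩ : 8 * cutCount ℓ S 0 = Fintype.card X ∧ 0 < cutCount ℓ S 4 := by
      rcases htight S hS with h | h | h
      · omega
      · omega
      · exact h.2
    obtain ⟨x, hx⟩ := htrace4 S hpos
    refine hS (hkill (cutEdges ℓ S x) S (-1) ⟨x, rfl⟩ fun S' hS' hsub => ?_)
    have hc4 := Finset.card_le_card hsub
    rcases htight S' hS' with h | h | h
    · omega
    · exfalso
      have hS'eq := Finset.eq_of_subset_of_card_le hsub (by omega)
      have hle : cutCount ℓ S 0 ≤ cutCount ℓ S' 0 := by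
        refine Finset.card_le_card fun y hy => ?_
        simp only [Finset.mem_filter, Finset.mem_univ, true_and] at hy ⊢
        rw [← hS'eq]
        have hmono : cutEdges ℓ (cutEdges ℓ S x) y ⊆ cutEdges ℓ S y :=
          Finset.filter_subset_filter _ (Finset.filter_subset _ _)
        exact Nat.le_zero.mp ((Finset.card_le_card hmono).trans hy.le)
      have := cutCount_zero_pos ℓ S
      omega
    · rw [h.1]; norm_num
  refine exists_forall_mem_iff_subset hup heq fun S hS => ?_
  rcases htight S hS with h | h | h
  · exact h
  · exfalso
    obtain ⟨x, hx⟩ := htrace4 S h.2.2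
    have hxS : cutEdges ℓ S x = S :=
      Finset.eq_of_subset_of_card_le (Finset.filter_subset _ _) (by omega)
    refine hS (hkill S S 1 ⟨x, hxS⟩ fun S' hS' hsub => ?_)
    have hc4 := Finset.card_le_card hsub
    rcases htight S' hS' with h' | h' | h'
    · omega
    · rw [h'.1]; norm_num
    · exact absurd h'.1 (hfive S' hS')
  · exact absurd h.1 (hfive S hS)

end Extremal

section BiasedMeasure

variable {ι : Type*}

open Classical in
/-- The `p`-biased measure, on the subsets of `E`, of the family of sets satisfying `P`. -/
noncomputable def biasedMeasure (p : ℝ) (E : Finset ι) (P : Finset ι → Prop) : ℝ :=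
  ∑ G ∈ E.powerset, if P G then p ^ G.card * (1 - p) ^ (E.card - G.card) else 0

lemma biasedMeasure_eq_sum_filter (p : ℝ) (E : Finset ι) (P : Finset ι → Prop)
    [DecidablePred P] : biasedMeasure p E P
      = ∑ G ∈ E.powerset.filter P, p ^ G.card * (1 - p) ^ (E.card - G.card) := by
  rw [Finset.sum_filter]
  exact Finset.sum_congr rfl fun G _ => by congr

lemma biasedMeasure_insert [DecidableEq ι] (p : ℝ) {E : Finset ι} {a : ι} (ha : a ∉ E) (P : Finset ι → Prop) :
    biasedMeasure p (insert a E) P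
      = (1 - p) * biasedMeasure p E P + p * biasedMeasure p E fun G => P (insert a G) := by
  unfold biasedMeasure
  rw [Finset.sum_powerset_insert ha, Finset.mul_sum, Finset.mul_sum]
  congr 1
  · refine Finset.sum_congr rfl fun G hG => ?_
    have hle := Finset.card_le_card (Finset.mem_powerset.mp hG)
    rw [Finset.card_insert_of_notMem ha, Nat.sub_add_comm hle, pow_succ]
    split_ifs <;> ring
  · refine Finset.sum_congr rfl fun G hG => ?_
    have haG : a ∉ G := fun h => ha (Finset.mem_powerset.mp hG h)
    rw [Finset.card_insert_of_notMem ha, Finset.card_insert_of_notMem haG, Nat.add_sub_add_right,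
      pow_succ]
    split_ifs <;> ring

lemma biasedMeasure_mono {p : ℝ} (hp0 : 0 ≤ p) (hp1 : p ≤ 1) {E : Finset ι}
    {P Q : Finset ι → Prop} (h : ∀ G, P G → Q G) :
    biasedMeasure p E P ≤ biasedMeasure p E Q := by
  have h1 : 0 ≤ 1 - p := by linarith
  refine Finset.sum_le_sum fun G _ => ?_
  by_cases hP : P G
  · rw [if_pos hP, if_pos (h G hP)]
  · rw [if_neg hP]
    split_ifs
    · positivity
    · exact le_rfl

lemma biasedMeasure_nonneg {p : ℝ} (hp0 : 0 ≤ p) (hp1 : p ≤ 1) (E : Finset ι)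
    (P : Finset ι → Prop) : 0 ≤ biasedMeasure p E P := by
  have h1 : 0 ≤ 1 - p := by linarith
  refine Finset.sum_nonneg fun G _ => ?_
  split_ifs
  · positivity
  · exact le_rfl

lemma forall_of_biasedMeasure_eq {p : ℝ} (hp0 : 0 < p) (hp1 : p < 1) {E : Finset ι}
    {P Q : Finset ι → Prop} (h : ∀ G, P G → Q G)
    (heq : biasedMeasure p E P = biasedMeasure p E Q) : ∀ G ⊆ E, Q G → P G := by
  have h1 : 0 < 1 - p := by linarith
  intro G hG hQ
  by_contra hP
  refine heq.not_lt ?_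
  refine Finset.sum_lt_sum (fun G _ => ?_) ⟨G, Finset.mem_powerset.mpr hG, ?_⟩
  · by_cases hP : P G
    · rw [if_pos hP, if_pos (h G hP)]
    · rw [if_neg hP]
      split_ifs
      · positivity
      · exact le_rfl
  · rw [if_neg hP, if_pos hQ]; positivity

lemma biasedMeasure_superset [DecidableEq ι] (p : ℝ) {E T : Finset ι} (hT : T ⊆ E) :
    biasedMeasure p E (T ⊆ ·) = p ^ T.card := by
  have h := Finset.sum_pow_mul_eq_add_pow p (1 - p) (E \ T)
  rw [add_sub_cancel, one_pow] at h
  have hsum : p ^ T.card = ∑ A ∈ (E \ T).powerset,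
      p ^ T.card * (p ^ A.card * (1 - p) ^ ((E \ T).card - A.card)) := by
    rw [← Finset.mul_sum, h, mul_one]
  rw [biasedMeasure_eq_sum_filter, hsum]
  symm
  refine Finset.sum_nbij' (fun A => T ∪ A) (fun G => G \ T) ?_ ?_ ?_ ?_ ?_
  · intro A hA
    rw [Finset.mem_powerset] at hA
    simp only [Finset.mem_filter, Finset.mem_powerset]
    exact ⟨Finset.union_subset hT (hA.trans Finset.sdiff_subset), Finset.subset_union_left⟩
  · intro G hG
    simp only [Finset.mem_filter, Finset.mem_powerset] at hG ⊢
    exact Finset.sdiff_subset_sdiff hG.1 subset_rfl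
  · intro A hA
    rw [Finset.mem_powerset] at hA
    rw [Finset.union_sdiff_left, Finset.sdiff_eq_self_iff_disjoint]
    exact Finset.disjoint_of_subset_left hA Finset.sdiff_disjoint
  · intro G hG
    simp only [Finset.mem_filter] at hG
    exact Finset.union_sdiff_of_subset hG.2
  · intro A hA
    rw [Finset.mem_powerset] at hA
    have hd : Disjoint T A := (Finset.disjoint_of_subset_left hA Finset.sdiff_disjoint).symm
    rw [Finset.card_union_of_disjoint hd, Finset.card_sdiff_of_subset hT, pow_add,
      Nat.sub_add_eq, mul_assoc]

lemma one_sub_rpow_mul_add_le {q α x y : ℝ} (hq0 : 0 ≤ q) (hq1 : q ≤ 1) (hα : 1 ≤ α)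
    (hx : 0 ≤ x) (hxy : x ≤ y) :
    (1 - q ^ α) * x ^ α + q ^ α * y ^ α ≤ ((1 - q) * x + q * y) ^ α := by
  have hy : 0 ≤ y := hx.trans hxy
  rw [sub_mul, one_mul, ← Real.mul_rpow hq0 hx, ← Real.mul_rpow hq0 hy]
  have hconv := convexOn_rpow hα
  set z := (1 - q) * x + q * y with hz
  have hqx : q * x ≤ x := mul_le_of_le_one_left hx hq1
  have hqxy : q * x ≤ q * y := mul_le_mul_of_nonneg_left hxy hq0
  rcases (show q * x ≤ z by rw [hz]; linarith).eq_or_lt with h | h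
  · have h1 : x = q * x := by linarith
    have h2 : q * y = z := by linarith
    rw [h2, ← h1]; linarith
  · set t := (x - q * x) / (z - q * x) with ht
    have hd : 0 < z - q * x := by linarith
    have ht0 : 0 ≤ t := div_nonneg (by linarith) hd.le
    have ht1 : t ≤ 1 := by rw [ht, div_le_one hd, hz]; linarith
    have htd : t * (z - q * x) = x - q * x := by rw [ht, div_mul_cancel₀ _ hd.ne']
    have hz0 : 0 ≤ z := le_trans (mul_nonneg hq0 hx) h.le
    have h1 := hconv.2 (mul_nonneg hq0 hx) hz0 (sub_nonneg.mpr ht1) ht0 (by ring)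
    have h2 := hconv.2 (mul_nonneg hq0 hx) hz0 ht0 (sub_nonneg.mpr ht1) (by ring)
    simp only [smul_eq_mul] at h1 h2
    rw [show (1 - t) * (q * x) + t * z = x by linarith] at h1
    rw [show t * (q * x) + (1 - t) * z = q * y by linarith] at h2
    linarith

/-- For an up-set, `log_p` of the `p`-biased measure is non-increasing in `p`. -/
lemma biasedMeasure_rpow_le [DecidableEq ι] {q α : ℝ} (hq0 : 0 ≤ q) (hq1 : q ≤ 1) (hα : 1 ≤ α)
    (E : Finset ι) {P : Finset ι → Prop} (hP : ∀ G H, G ⊆ H → P G → P H) :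
    biasedMeasure (q ^ α) E P ≤ biasedMeasure q E P ^ α := by
  have hα0 : α ≠ 0 := by linarith
  have hqα0 : 0 ≤ q ^ α := Real.rpow_nonneg hq0 α
  have hqα1 : q ^ α ≤ 1 := Real.rpow_le_one hq0 hq1 (by linarith)
  induction E using Finset.induction_on generalizing P with
  | empty =>
    by_cases h : P ∅ <;> simp [biasedMeasure, h, hα0]
  | insert a E ha ih =>
    rw [biasedMeasure_insert _ ha, biasedMeasure_insert _ ha]
    have h0 := ih hP
    have h1 := ih (P := fun G => P (insert a G)) fun G H hGH =>
      hP _ _ (Finset.insert_subset_insert a hGH)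
    refine le_trans (add_le_add (mul_le_mul_of_nonneg_left h0 (by linarith))
      (mul_le_mul_of_nonneg_left h1 hqα0)) ?_
    exact one_sub_rpow_mul_add_le hq0 hq1 hα (biasedMeasure_nonneg hq0 hq1 _ _)
      (biasedMeasure_mono hq0 hq1 fun G => hP _ _ (Finset.subset_insert a G))

open Classical in
lemma biasedMeasure_half (E : Finset ι) (P : Finset ι → Prop) :
    biasedMeasure (1 / 2) E P = (E.powerset.filter P).card / 2 ^ E.card := by
  rw [biasedMeasure_eq_sum_filter, Finset.sum_congr rfl (g := fun _ => ((2 : ℝ) ^ E.card)⁻¹),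
    Finset.sum_const, nsmul_eq_mul, div_eq_mul_inv]
  intro G hG
  have hle := Finset.card_le_card (Finset.mem_powerset.mp (Finset.mem_filter.mp hG).1)
  rw [show (1 : ℝ) - 1 / 2 = 1 / 2 by norm_num, ← pow_add, Nat.add_sub_cancel' hle]
  simp

end BiasedMeasure

section OddCycles

variable {n : ℕ}

/-- The functional on vertex labelings whose value at an edge is the sum of the labels of its
endpoints. -/
def edgeFunctional (e : Sym2 (Fin n)) : (Fin n → ZMod 2) →+ ZMod 2 :=
  Sym2.lift ⟨fun a b => Pi.evalAddMonoidHom (fun _ => ZMod 2) a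
    + Pi.evalAddMonoidHom (fun _ => ZMod 2) b, fun _ _ => add_comm _ _⟩ e

lemma edgeFunctional_mk (a b : Fin n) (x : Fin n → ZMod 2) :
    edgeFunctional s(a, b) x = x a + x b := rfl

lemma edgeFunctional_single {e : Sym2 (Fin n)} (he : ¬ e.IsDiag) (v : Fin n) :
    edgeFunctional e (Pi.single v 1) = 1 ↔ v ∈ e := by
  induction e using Sym2.ind with
  | _ a b =>
    rw [Sym2.mk_isDiag_iff] at he
    rw [edgeFunctional_mk, Sym2.mem_iff, Pi.single_apply, Pi.single_apply]
    by_cases h1 : a = v <;> by_cases h2 : b = v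
    · exact absurd (h1.trans h2.symm) he
    · simp [h1, h2]
    · simp [h1, h2]
    · simp [h1, h2, Ne.symm h1, Ne.symm h2]

lemma edgeFunctional_ne_zero {e : Sym2 (Fin n)} (he : ¬ e.IsDiag) : edgeFunctional e ≠ 0 := by
  intro h
  obtain ⟨v, hv⟩ : ∃ v, v ∈ e := ⟨e.out.1, e.out_fst_mem⟩
  have := (edgeFunctional_single he v).mpr hv
  rw [h] at this
  simp at this

lemma edgeFunctional_inj {e e' : Sym2 (Fin n)} (he : ¬ e.IsDiag) (he' : ¬ e'.IsDiag)
    (h : edgeFunctional e = edgeFunctional e') : e = e' := by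
  ext v
  rw [← edgeFunctional_single he, ← edgeFunctional_single he', h]

lemma mem_edgeFinset {e : Sym2 (Fin n)} : e ∈ edgeFinset n ↔ ¬ e.IsDiag := by
  simp [edgeFinset]

lemma card_edgeFinset (n : ℕ) : (edgeFinset n).card = n.choose 2 := by
  rw [edgeFinset, ← Fintype.card_subtype, Sym2.card_subtype_not_diag, Fintype.card_fin]

lemma graphOf_adj {G : Finset (Sym2 (Fin n))} {a b : Fin n} :
    (graphOf G).Adj a b ↔ s(a, b) ∈ G ∧ a ≠ b := by
  simp [graphOf]

lemma HasOddCycle.exists_edgeFunctional_eq_zero {G : Finset (Sym2 (Fin n))} (hG : HasOddCycle G)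
    (x : Fin n → ZMod 2) : ∃ e ∈ G, edgeFunctional e x = 0 := by
  by_contra! hne
  have hwalk : ∀ (u v : Fin n) (w : (graphOf G).Walk u v), (w.length : ZMod 2) = x u + x v := by
    intro u v w
    induction w with
    | nil =>
      have h2 : ∀ a : ZMod 2, 0 = a + a := by decide
      simpa using h2 _
    | @cons a b c h w ih =>
      have h1 := hne _ (graphOf_adj.mp h).1
      rw [edgeFunctional_mk] at h1
      rw [SimpleGraph.Walk.length_cons, Nat.cast_succ, ih]
      have h3 : ∀ a b c : ZMod 2, a + b ≠ 0 → b + c + 1 = a + c := by decide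
      exact h3 _ _ _ h1
  obtain ⟨v, w, -, hodd⟩ := hG
  have h1 := hwalk v v w
  rw [(ZMod.natCast_eq_one_iff_odd).mpr hodd] at h1
  have h2 : ∀ a : ZMod 2, 1 ≠ a + a := by decide
  exact h2 _ h1

lemma HasOddCycle.isTriangle {T : Finset (Sym2 (Fin n))} (hT : HasOddCycle T)
    (hcard : T.card = 3) : IsTriangle T := by
  obtain ⟨v, w, hw, -⟩ := hT
  have hsub : w.edges.toFinset ⊆ T := by
    intro e he
    have h := w.edges_subset_edgeSet (List.mem_toFinset.mp he)
    simp only [graphOf, SimpleGraph.edgeSet_fromEdgeSet] at h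
    exact h.1
  have hlen : w.edges.toFinset.card = w.length := by
    rw [List.toFinset_card_of_nodup hw.edges_nodup, SimpleGraph.Walk.length_edges]
  have h3 := hw.three_le_length
  have hle := Finset.card_le_card hsub
  have hTeq := Finset.eq_of_subset_of_card_le hsub (by omega)
  have hlen3 : w.length = 3 := by omega
  clear hle hlen h3 hsub hw
  match w, hlen3, hTeq with
  | .cons (v := b) h1 (.cons (v := c) h2 (.cons h3 .nil)), _, hTeq =>
    refine ⟨v, b, c, (graphOf_adj.mp h1).2, (graphOf_adj.mp h3).2.symm,
      (graphOf_adj.mp h2).2, ?_⟩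
    rw [← hTeq]
    ext e
    simp [Sym2.eq_swap (a := c) (b := v)]
    tauto

lemma IsTriangle.card_eq {T : Finset (Sym2 (Fin n))} (hT : IsTriangle T) : T.card = 3 := by
  obtain ⟨a, b, c, hab, hac, hbc, rfl⟩ := hT
  rw [Finset.card_eq_three]
  refine ⟨_, _, _, ?_, ?_, ?_, rfl⟩ <;> simp <;> grind

lemma IsTriangle.subset_edgeFinset {T : Finset (Sym2 (Fin n))} (hT : IsTriangle T) :
    T ⊆ edgeFinset n := by
  obtain ⟨a, b, c, hab, hac, hbc, rfl⟩ := hT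
  intro e he
  rw [mem_edgeFinset]
  simp only [Finset.mem_insert, Finset.mem_singleton] at he
  rcases he with rfl | rfl | rfl <;> simpa

lemma muPFam_eq_biasedMeasure (p : ℝ) {F : Finset (Finset (Sym2 (Fin n)))}
    (hF : F ⊆ (edgeFinset n).powerset) :
    muPFam n p F = biasedMeasure p (edgeFinset n) (· ∈ F) := by
  unfold muPFam muP
  rw [biasedMeasure_eq_sum_filter, Finset.filter_mem_eq_inter, Finset.inter_eq_right.mpr hF,
    card_edgeFinset]

/-- The case `p = 1 / 2` for families closed upwards. -/
lemma biasedMeasure_half_le {P : Finset (Sym2 (Fin n)) → Prop} (hP : ∀ G H, G ⊆ H → P G → P H)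
    (hodd : ∀ G H, P G → P H → HasOddCycle (G ∩ H)) :
    biasedMeasure (1 / 2) (edgeFinset n) P ≤ 1 / 8 ∧
      (biasedMeasure (1 / 2) (edgeFinset n) P = 1 / 8 →
        ∃ T ⊆ edgeFinset n, IsTriangle T ∧ ∀ G ⊆ edgeFinset n, P G ↔ T ⊆ G) := by
  classical
  let emb : {e // e ∈ edgeFinset n} ↪ Sym2 (Fin n) := Function.Embedding.subtype _
  let F : Finset (Finset {e // e ∈ edgeFinset n}) := Finset.univ.filter fun G => P (G.map emb)
  have hmemF : ∀ G, G ∈ F ↔ P (G.map emb) := fun G => by simp [F]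
  have hmap : ∀ G ⊆ edgeFinset n, (G.subtype (· ∈ edgeFinset n)).map emb = G := fun G hG =>
    Finset.subtype_map_of_mem fun e he => hG he
  have hmapsub : ∀ G : Finset {e // e ∈ edgeFinset n}, G.map emb ⊆ edgeFinset n := by
    intro G e he
    obtain ⟨e', -, rfl⟩ := Finset.mem_map.mp he
    exact e'.2
  have hcard : F.card = ((edgeFinset n).powerset.filter P).card := by
    refine Finset.card_nbij (fun G => G.map emb) ?_ ?_ ?_
    · intro G hG
      simp only [Finset.mem_coe, Finset.mem_filter, Finset.mem_powerset] at hG ⊢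
      exact ⟨hmapsub G, (hmemF G).mp hG⟩
    · exact (Finset.map_injective emb).injOn
    · intro G hG
      simp only [Finset.mem_coe, Finset.mem_filter, Finset.mem_powerset] at hG
      refine ⟨G.subtype (· ∈ edgeFinset n), ?_, hmap G hG.1⟩
      rw [Finset.mem_coe, hmemF, hmap G hG.1]
      exact hG.2
  have hmain := eight_mul_card_le_of_cut_intersecting (X := Fin n → ZMod 2) (d := n) (by simp)
    (fun e : {e // e ∈ edgeFinset n} => edgeFunctional e.1)
    (fun e e' h => Subtype.ext
      (edgeFunctional_inj (mem_edgeFinset.mp e.2) (mem_edgeFinset.mp e'.2) h))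
    (fun e => edgeFunctional_ne_zero (mem_edgeFinset.mp e.2)) (F := F)
    (fun G H hGH hG => by
      rw [Finset.mem_coe, hmemF] at hG ⊢
      exact hP _ _ (Finset.map_subset_map.mpr hGH) hG)
    (fun G hG H hH x => by
      obtain ⟨e, he, hex⟩ := (hodd _ _ ((hmemF G).mp hG)
        ((hmemF H).mp hH)).exists_edgeFunctional_eq_zero x
      rw [← Finset.map_inter] at he
      obtain ⟨e', he', rfl⟩ := Finset.mem_map.mp he
      exact ⟨e', he', hex⟩)
  rw [Fintype.card_coe] at hmain
  have hpow : (0 : ℝ) < 2 ^ (edgeFinset n).card := by positivity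
  rw [biasedMeasure_half, ← hcard, div_le_div_iff₀ hpow (by norm_num), div_eq_div_iff hpow.ne'
    (by norm_num)]
  refine ⟨?_, fun h => ?_⟩
  · have h : (8 * F.card : ℝ) ≤ 2 ^ (edgeFinset n).card := by exact_mod_cast hmain.1
    linarith
  · obtain ⟨T, hT, hiff⟩ := hmain.2 (by
      have h' : (8 * F.card : ℝ) = 2 ^ (edgeFinset n).card := by linarith
      exact_mod_cast h')
    have hPT : P (T.map emb) := (hmemF T).mp ((hiff T).mpr subset_rfl)
    refine ⟨T.map emb, hmapsub T, ?_, fun G hG => ?_⟩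
    · have h := hodd _ _ hPT hPT
      rw [Finset.inter_self] at h
      exact h.isTriangle (by rw [Finset.card_map, hT])
    · have h := hiff (G.subtype (· ∈ edgeFinset n))
      rw [hmemF, hmap G hG] at h
      rw [h, ← Finset.map_subset_map (f := emb), hmap G hG]

end OddCycles

theorem odd_cycle_intersecting_measure_bound
    (n : ℕ) (hn : 3 ≤ n) (p : ℝ) (hp0 : 0 < p) (hp : p ≤ 1 / 2)
    (F : Finset (Finset (Sym2 (Fin n))))
    (hF : F ⊆ (edgeFinset n).powerset)
    (hInt : OddCycleIntersecting F) :
    muPFam n p F ≤ p ^ 3 ∧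
      (muPFam n p F = p ^ 3 ↔
        ∃ T : Finset (Sym2 (Fin n)), IsTriangle T ∧
          F = (edgeFinset n).powerset.filter (fun G => T ⊆ G)) := by
  let P : Finset (Sym2 (Fin n)) → Prop := fun G => ∃ A ∈ F, A ⊆ G
  have hP : ∀ G H, G ⊆ H → P G → P H := fun G H hGH ⟨A, hA, hAG⟩ => ⟨A, hA, hAG.trans hGH⟩
  have hodd : ∀ G H, P G → P H → HasOddCycle (G ∩ H) := by
    rintro G H ⟨A, hA, hAG⟩ ⟨B, hB, hBH⟩
    obtain ⟨v, w, hw, hlen⟩ := hInt A hA B hB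
    have hle : graphOf (A ∩ B) ≤ graphOf (G ∩ H) := by
      refine SimpleGraph.fromEdgeSet_mono ?_
      exact_mod_cast Finset.inter_subset_inter hAG hBH
    exact ⟨v, w.mapLe hle, hw.mapLe hle, by rwa [SimpleGraph.Walk.length_mapLe]⟩
  have hFP : ∀ G, G ∈ F → P G := fun G hG => ⟨G, hG, subset_rfl⟩
  have hp1 : p < 1 := by linarith
  obtain ⟨α, hα, rfl⟩ : ∃ α : ℝ, 1 ≤ α ∧ (1 / 2 : ℝ) ^ α = p := by
    refine ⟨Real.logb (1 / 2) p, ?_, Real.rpow_logb (by norm_num) (by norm_num) hp0⟩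
    rw [Real.le_logb_iff_rpow_le_of_base_lt_one (by norm_num) (by norm_num) hp0]
    simpa using hp
  have hα0 : 0 < α := by linarith
  have hcube : ((1 / 2 : ℝ) ^ α) ^ 3 = (1 / 8) ^ α := by
    rw [← Real.rpow_natCast, ← Real.rpow_mul (by norm_num), mul_comm, Real.rpow_mul (by norm_num)]
    norm_num
  have hhalf := biasedMeasure_half_le hP hodd
  have hhalf0 : 0 ≤ biasedMeasure (1 / 2) (edgeFinset n) P :=
    biasedMeasure_nonneg (by norm_num) (by norm_num) _ _
  have h1 := biasedMeasure_mono hp0.le hp1.le (E := edgeFinset n) hFP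
  have h2 := biasedMeasure_rpow_le (q := 1 / 2) (by norm_num) (by norm_num) hα (edgeFinset n) hP
  have h3 : biasedMeasure (1 / 2) (edgeFinset n) P ^ α ≤ (1 / 8) ^ α :=
    Real.rpow_le_rpow hhalf0 hhalf.1 hα0.le
  rw [muPFam_eq_biasedMeasure _ hF, hcube]
  refine ⟨h1.trans (h2.trans h3), fun heq => ?_, ?_⟩
  · have h4 : biasedMeasure (1 / 2) (edgeFinset n) P = 1 / 8 := by
      refine le_antisymm hhalf.1 (le_of_not_gt fun hlt => ?_)
      have := Real.rpow_lt_rpow hhalf0 hlt hα0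
      linarith
    obtain ⟨T, -, hT, hiff⟩ := hhalf.2 h4
    refine ⟨T, hT, ?_⟩
    have hback := forall_of_biasedMeasure_eq hp0 hp1 hFP (by linarith)
    ext G
    rw [Finset.mem_filter, Finset.mem_powerset]
    constructor
    · intro hG
      have hGE := Finset.mem_powerset.mp (hF hG)
      exact ⟨hGE, (hiff G hGE).mp (hFP G hG)⟩
    · rintro ⟨hGE, hTG⟩
      exact hback G hGE ((hiff G hGE).mpr hTG)
  · rintro ⟨T, hT, rfl⟩
    rw [← hcube, ← hT.card_eq, ← biasedMeasure_superset _ hT.subset_edgeFinset]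
    unfold biasedMeasure
    refine Finset.sum_congr rfl fun G hG => ?_
    simp only [Finset.mem_filter, hG, true_and]
    congr
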